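/- Let p be an odd prime and n a positive even integer with B_n ≠ 0. Set t₀ := max( v_p(n), v_p(B_n/n) ) and t := t₀ + 1. If m is another positive integer with m ≡ n (mod (p−1)p^t), then B_m ≠ 0 and v_p(B_m) = v_p(B_n). -/

import Mathlib

open Finset Filter Topology

/-- The sum `∑ k < N, ⌊ck / N⌋ (ck) ^ (n - 1)` occurring in Voronoi's congruence. -/
def voronoiSum (c n N : ℕ) : ℤ :=
  ∑ k ∈ range N, ((c * k / N : ℕ) : ℤ) * ((c * k : ℕ) : ℤ) ^ (n - 1)

theorem sum_range_mul_mod {M : Type*} [AddCommMonoid M] {c N : ℕ} (hc : c.Coprime N) (f : ℕ → M) :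
    ∑ k ∈ range N, f (c * k % N) = ∑ k ∈ range N, f k := by
  have hmaps : Set.MapsTo (fun k ↦ c * k % N) (range N : Set ℕ) (range N : Set ℕ) := fun k hk ↦ by
    simp only [coe_range, Set.mem_Iio] at hk ⊢
    exact Nat.mod_lt _ (by lia)
  have hinj : Set.InjOn (fun k ↦ c * k % N) (range N : Set ℕ) := fun a ha b hb hab ↦ by
    simp only [coe_range, Set.mem_Iio] at ha hb
    exact (Nat.ModEq.cancel_left_of_coprime hc.symm hab).eq_of_lt_of_lt ha hb
  exact sum_nbij (fun k ↦ c * k % N) hmaps hinj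
    (surjOn_of_injOn_of_card_le _ hmaps hinj le_rfl) fun _ _ ↦ rfl

/-- **Voronoi's congruence** for power sums. -/
theorem exists_voronoi {c N : ℕ} (hc : c.Coprime N) (n : ℕ) :
    ∃ K : ℤ, ((c : ℤ) ^ n - 1) * ∑ k ∈ range N, (k : ℤ) ^ n =
      n * N * voronoiSum c n N + N ^ 2 * K := by
  have hterm (k : ℕ) : ∃ K : ℤ, ((c * k % N : ℕ) : ℤ) ^ n = (c : ℤ) ^ n * (k : ℤ) ^ n -
      n * N * (((c * k / N : ℕ) : ℤ) * ((c * k : ℕ) : ℤ) ^ (n - 1)) + N ^ 2 * K := by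
    obtain ⟨K, hK⟩ := Polynomial.powAddExpansion
      ((c * k : ℕ) : ℤ) (-((N : ℤ) * ((c * k / N : ℕ) : ℤ))) n
    refine ⟨K * ((c * k / N : ℕ) : ℤ) ^ 2, ?_⟩
    have hmod : ((c * k % N : ℕ) : ℤ) = ((c * k : ℕ) : ℤ) + -((N : ℤ) * ((c * k / N : ℕ) : ℤ)) := by
      have := Nat.mod_add_div (c * k) N
      zify at this ⊢
      linarith
    rw [hmod, hK, Nat.cast_mul c k]
    ring
  choose K hK using hterm
  refine ⟨-∑ k ∈ range N, K k, ?_⟩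
  have := sum_range_mul_mod hc fun k ↦ (k : ℤ) ^ n
  simp only [hK, sum_add_distrib, sum_sub_distrib, ← mul_sum] at this
  rw [voronoiSum]
  linarith

section Padic

variable {p : ℕ} [Fact p.Prime]

theorem tendsto_padic_natCast_prime_pow :
    Tendsto (fun r : ℕ ↦ (p : ℚ_[p]) ^ r) atTop (𝓝 0) :=
  tendsto_pow_atTop_nhds_zero_of_norm_lt_one Padic.norm_p_lt_one

theorem tendsto_sum_range_prime_pow_div (n : ℕ) :
    Tendsto (fun r : ℕ ↦ (∑ k ∈ range (p ^ r), (k : ℚ_[p]) ^ n) / (p : ℚ_[p]) ^ r) atTop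
      (𝓝 (bernoulli n : ℚ_[p])) := by
  have hp0 : (p : ℚ_[p]) ≠ 0 := mod_cast (Fact.out : p.Prime).ne_zero
  have hcont : Continuous fun x : ℚ_[p] ↦
      ∑ i ∈ range (n + 1), (bernoulli i : ℚ_[p]) * ((n + 1).choose i) * x ^ (n - i) / (n + 1) := by
    fun_prop
  have hlim := (hcont.tendsto 0).comp (tendsto_padic_natCast_prime_pow (p := p))
  have hzero : ∑ i ∈ range (n + 1), (bernoulli i : ℚ_[p]) * ((n + 1).choose i) *
      0 ^ (n - i) / (n + 1) = bernoulli n := by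
    rw [sum_range_succ, sum_eq_zero fun i hi ↦ ?_]
    · have : (n + 1 : ℚ_[p]) ≠ 0 := mod_cast n.succ_ne_zero
      simp [Nat.choose_succ_self_right, this]
    · have : n - i ≠ 0 := by grind
      simp [this]
  rw [hzero] at hlim
  refine hlim.congr fun r ↦ ?_
  have h := congrArg (fun q : ℚ ↦ (q : ℚ_[p])) (sum_range_pow (p ^ r) n)
  push_cast at h
  rw [Function.comp_apply, h, sum_div]
  refine sum_congr rfl fun i hi ↦ ?_
  rw [show n + 1 - i = n - i + 1 by grind, pow_succ]
  field_simp

theorem tendsto_voronoiSum {c n : ℕ} (hc : c.Coprime p) (hn : n ≠ 0) :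
    Tendsto (fun r : ℕ ↦ (voronoiSum c n (p ^ r) : ℚ_[p])) atTop
      (𝓝 (((c : ℚ_[p]) ^ n - 1) * (bernoulli n / n))) := by
  have hp0 : (p : ℚ_[p]) ≠ 0 := mod_cast (Fact.out : p.Prime).ne_zero
  have hn0 : (n : ℚ_[p]) ≠ 0 := mod_cast hn
  choose K hK using fun r : ℕ ↦ exists_voronoi (hc.pow_right r) n
  have herr : Tendsto (fun r : ℕ ↦ (p : ℚ_[p]) ^ r * K r) atTop (𝓝 0) := by
    refine squeeze_zero_norm (fun r ↦ ?_)
      (tendsto_zero_iff_norm_tendsto_zero.1 (tendsto_padic_natCast_prime_pow (p := p)))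
    rw [norm_mul]
    exact mul_le_of_le_one_right (norm_nonneg _) (Padic.norm_int_le_one _)
  have hlim := (((tendsto_sum_range_prime_pow_div (p := p) n).const_mul
    ((c : ℚ_[p]) ^ n - 1)).sub herr).div_const (n : ℚ_[p])
  rw [sub_zero, mul_div_assoc] at hlim
  refine hlim.congr fun r ↦ ?_
  have h := congrArg (fun z : ℤ ↦ (z : ℚ_[p])) (hK r)
  push_cast at h
  field_simp
  linear_combination h

theorem sum_range_prime_pow_succ_not_dvd {M : Type*} [AddCommGroup M] (r : ℕ) (f : ℕ → M) :
    ∑ k ∈ range (p ^ (r + 1)) with ¬p ∣ k, f k =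
      ∑ k ∈ range (p ^ (r + 1)), f k - ∑ j ∈ range (p ^ r), f (p * j) := by
  have hp : 0 < p := (Fact.out : p.Prime).pos
  have hdvd : ∑ k ∈ range (p ^ (r + 1)) with p ∣ k, f k = ∑ j ∈ range (p ^ r), f (p * j) := by
    symm
    refine sum_nbij (fun j ↦ p * j) (fun j hj ↦ ?_) (fun a _ b _ h ↦ ?_) (fun k hk ↦ ?_)
      fun _ _ ↦ rfl
    · simp only [mem_range, mem_filter] at hj ⊢
      exact ⟨by rw [pow_succ']; gcongr, dvd_mul_right _ _⟩
    · exact Nat.eq_of_mul_eq_mul_left hp h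
    · obtain ⟨hk, j, rfl⟩ := by simpa using hk
      rw [pow_succ'] at hk
      exact ⟨j, by simpa using lt_of_mul_lt_mul_left hk hp.le, rfl⟩
  rw [← hdvd, ← sum_filter_add_sum_filter_not (range (p ^ (r + 1))) (p ∣ ·) f, add_sub_cancel_left]

variable (p) in
/-- The part of `voronoiSum c n (p ^ (r + 1))` indexed by the integers prime to `p`. -/
def voronoiUnitSum (c n r : ℕ) : ℤ :=
  ∑ k ∈ range (p ^ (r + 1)) with ¬p ∣ k,
    ((c * k / p ^ (r + 1) : ℕ) : ℤ) * ((c * k : ℕ) : ℤ) ^ (n - 1)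

theorem voronoiUnitSum_eq (c n r : ℕ) :
    voronoiUnitSum p c n r =
      voronoiSum c n (p ^ (r + 1)) - p ^ (n - 1) * voronoiSum c n (p ^ r) := by
  rw [voronoiUnitSum, sum_range_prime_pow_succ_not_dvd, voronoiSum, voronoiSum, mul_sum]
  congr 1
  refine sum_congr rfl fun j _ ↦ ?_
  rw [mul_left_comm c p j, pow_succ', Nat.mul_div_mul_left _ _ (Fact.out : p.Prime).pos,
    Nat.cast_mul p, mul_pow]
  ring

theorem tendsto_voronoiUnitSum {c n : ℕ} (hc : c.Coprime p) (hn : n ≠ 0) :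
    Tendsto (fun r : ℕ ↦ (voronoiUnitSum p c n r : ℚ_[p])) atTop
      (𝓝 ((1 - (p : ℚ_[p]) ^ (n - 1)) * (((c : ℚ_[p]) ^ n - 1) * (bernoulli n / n)))) := by
  have h := tendsto_voronoiSum (p := p) hc hn
  rw [one_sub_mul]
  refine (((tendsto_add_atTop_iff_nat 1).2 h).sub (h.const_mul ((p : ℚ_[p]) ^ (n - 1)))).congr
    fun r ↦ ?_
  rw [voronoiUnitSum_eq]
  push_cast
  ring

theorem Nat.ModEq.pow_of_coprime_prime {m n t a : ℕ} (ht : t ≠ 0)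
    (hmn : m ≡ n [MOD (p - 1) * p ^ t]) (ha : a.Coprime p) : a ^ m ≡ a ^ n [MOD p ^ t] := by
  have hφ : (p ^ t).totient ∣ (p - 1) * p ^ t := by
    rw [Nat.totient_prime_pow Fact.out (Nat.pos_of_ne_zero ht), mul_comm]
    exact mul_dvd_mul_left _ (pow_dvd_pow _ (Nat.sub_le _ _))
  have hmn' := hmn.of_dvd hφ
  let u := ZMod.unitOfCoprime a (ha.pow_right t)
  have hu : u ^ m = u ^ n :=
    pow_eq_pow_iff_modEq.2 (hmn'.of_dvd (orderOf_dvd_of_pow_eq_one (ZMod.pow_totient u)))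
  rw [← ZMod.natCast_eq_natCast_iff]
  simpa [u] using congrArg Units.val hu

theorem norm_voronoiUnitSum_sub_le {c m n t : ℕ} (hc : c.Coprime p) (ht : t ≠ 0) (hm : m ≠ 0)
    (hn : n ≠ 0) (hmn : m ≡ n [MOD (p - 1) * p ^ t]) (r : ℕ) :
    ‖(voronoiUnitSum p c m r : ℚ_[p]) - voronoiUnitSum p c n r‖ ≤ (p : ℝ) ^ (-t : ℤ) := by
  rw [← Int.cast_sub, Padic.norm_int_le_pow_iff_dvd, voronoiUnitSum, voronoiUnitSum,
    ← sum_sub_distrib]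
  refine dvd_sum fun k hk ↦ ?_
  rw [← mul_sub]
  refine Dvd.dvd.mul_left ?_ _
  have hck : (c * k).Coprime p :=
    hc.mul_left (((Fact.out : p.Prime).coprime_iff_not_dvd.2 (mem_filter.1 hk).2).symm)
  have hpred : m - 1 ≡ n - 1 [MOD (p - 1) * p ^ t] :=
    Nat.ModEq.add_right_cancel' 1 (by
      rwa [Nat.sub_add_cancel (Nat.pos_of_ne_zero hm), Nat.sub_add_cancel (Nat.pos_of_ne_zero hn)])
  have := (hpred.pow_of_coprime_prime ht hck).symm.dvd
  push_cast at this ⊢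
  exact this

/-- **Kummer's congruence** with Euler factors, multiplied by the usual regularising factors. -/
theorem norm_kummer_sub_le {c m n t : ℕ} (hc : c.Coprime p) (ht : t ≠ 0) (hm : m ≠ 0)
    (hn : n ≠ 0) (hmn : m ≡ n [MOD (p - 1) * p ^ t]) :
    ‖(1 - (p : ℚ_[p]) ^ (m - 1)) * (((c : ℚ_[p]) ^ m - 1) * (bernoulli m / m)) -
      (1 - (p : ℚ_[p]) ^ (n - 1)) * (((c : ℚ_[p]) ^ n - 1) * (bernoulli n / n))‖ ≤
      (p : ℝ) ^ (-t : ℤ) :=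
  le_of_tendsto' ((tendsto_voronoiUnitSum hc hm).sub (tendsto_voronoiUnitSum hc hn)).norm
    (norm_voronoiUnitSum_sub_le hc ht hm hn hmn)

theorem norm_one_sub_prime_pow {k : ℕ} (hk : k ≠ 0) : ‖1 - (p : ℚ_[p]) ^ k‖ = 1 := by
  have h : ‖(1 - (p : ℚ_[p]) ^ k) - 1‖ < ‖(1 : ℚ_[p])‖ := by
    rw [sub_sub_cancel_left, norm_neg, norm_pow, norm_one]
    exact pow_lt_one₀ (norm_nonneg _) Padic.norm_p_lt_one hk
  simpa using Padic.norm_eq_of_norm_sub_lt_right h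

theorem exists_coprime_pow_not_modEq_one {n : ℕ} (hn : ¬p - 1 ∣ n) :
    ∃ c : ℕ, c.Coprime p ∧ ¬c ^ n ≡ 1 [MOD p] := by
  have h := (FiniteField.forall_pow_eq_one_iff (ZMod p) n).not.2 (by rwa [ZMod.card])
  push Not at h
  obtain ⟨u, hu⟩ := h
  refine ⟨(u : ZMod p).val, ZMod.val_coe_unit_coprime u, fun hmod ↦ hu ?_⟩
  rw [← ZMod.natCast_eq_natCast_iff] at hmod
  ext
  simpa using hmod

theorem norm_natCast_pow_sub_one {c n : ℕ} (h : ¬c ^ n ≡ 1 [MOD p]) :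
    ‖(c : ℚ_[p]) ^ n - 1‖ = 1 := by
  have hle : ‖(((c : ℤ) ^ n - 1 : ℤ) : ℚ_[p])‖ ≤ 1 := Padic.norm_int_le_one _
  have hlt : ¬‖(((c : ℤ) ^ n - 1 : ℤ) : ℚ_[p])‖ < 1 := by
    rw [Padic.norm_intCast_lt_one_iff]
    intro hdvd
    exact h (Nat.modEq_iff_dvd.2 (by push_cast; exact hdvd)).symm
  push_cast at hle hlt
  exact le_antisymm hle (not_lt.1 hlt)

theorem norm_bernoulli_div_eq {m n t : ℕ} (ht : t ≠ 0) (hm : 1 < m) (hn : 1 < n)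
    (hpn : ¬p - 1 ∣ n) (hmn : m ≡ n [MOD (p - 1) * p ^ t])
    (hlt : (p : ℝ) ^ (-t : ℤ) < ‖(bernoulli n / n : ℚ_[p])‖) :
    ‖(bernoulli m / m : ℚ_[p])‖ = ‖(bernoulli n / n : ℚ_[p])‖ := by
  obtain ⟨c, hc, hcn⟩ := exists_coprime_pow_not_modEq_one hpn
  have hcm : ¬c ^ m ≡ 1 [MOD p] := fun h ↦
    hcn (((hmn.pow_of_coprime_prime ht hc).of_dvd (dvd_pow_self p ht)).symm.trans h)
  have hnorm {k : ℕ} (hk : 1 < k) (hck : ¬c ^ k ≡ 1 [MOD p]) :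
      ‖(1 - (p : ℚ_[p]) ^ (k - 1)) * (((c : ℚ_[p]) ^ k - 1) * (bernoulli k / k))‖ =
        ‖(bernoulli k / k : ℚ_[p])‖ := by
    rw [norm_mul, norm_mul, norm_one_sub_prime_pow (by lia), norm_natCast_pow_sub_one hck,
      one_mul, one_mul]
  rw [← hnorm hm hcm, ← hnorm hn hcn]
  refine Padic.norm_eq_of_norm_sub_lt_right
    ((norm_kummer_sub_le hc ht (by lia) (by lia) hmn).trans_lt ?_)
  rwa [hnorm hn hcn]

/-- If `p - 1` divides a positive even `n`, the denominator of `bernoulli n` is divisible by `p`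
exactly once. -/
theorem norm_bernoulli_of_sub_one_dvd {n : ℕ} (hn : n ≠ 0) (hne : Even n) (hpn : p - 1 ∣ n) :
    ‖(bernoulli n : ℚ_[p])‖ = p := by
  have hp : p.Prime := Fact.out
  obtain ⟨k, rfl⟩ := hne.two_dvd
  obtain ⟨z, hz⟩ := Bernoulli.vonStaudt_clausen k
  have hmem : p ∈ (range (2 * k + 2)).filter fun q ↦ q.Prime ∧ q - 1 ∣ 2 * k := by
    have := Nat.le_of_dvd (Nat.pos_of_ne_zero hn) hpn
    simp only [mem_filter, mem_range]
    exact ⟨by lia, hp, hpn⟩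
  rw [← add_sum_erase _ _ hmem] at hz
  have hz' := congrArg (fun q : ℚ ↦ (q : ℚ_[p])) hz
  push_cast at hz'
  have hsum : ‖∑ q ∈ ((range (2 * k + 2)).filter fun q ↦ q.Prime ∧ q - 1 ∣ 2 * k).erase p,
      (1 : ℚ_[p]) / q‖ ≤ 1 := by
    refine IsUltrametricDist.norm_sum_le_of_forall_le_of_nonneg zero_le_one fun q hq ↦ ?_
    simp only [mem_erase, mem_filter] at hq
    rw [norm_div, norm_one, Padic.norm_natCast_eq_one_iff.2
      ((Nat.coprime_primes hp hq.2.2.1).2 (Ne.symm hq.1)), div_one]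
  have hinv : ‖-(1 / (p : ℚ_[p]))‖ = p := by simp
  rw [← hinv]
  refine Padic.norm_eq_of_norm_sub_lt_right ?_
  rw [hinv, show (bernoulli (2 * k) : ℚ_[p]) - -(1 / (p : ℚ_[p])) = z -
    ∑ q ∈ ((range (2 * k + 2)).filter fun q ↦ q.Prime ∧ q - 1 ∣ 2 * k).erase p,
      (1 : ℚ_[p]) / q by linear_combination -hz',
    sub_eq_add_neg]
  exact ((Padic.nonarchimedean _ _).trans
    (max_le (Padic.norm_int_le_one z) (by rwa [norm_neg]))).trans_lt (mod_cast hp.one_lt)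

theorem padicValRat_eq_of_norm_eq {x y : ℚ} (hy : y ≠ 0) (h : ‖(x : ℚ_[p])‖ = ‖(y : ℚ_[p])‖) :
    x ≠ 0 ∧ padicValRat p x = padicValRat p y := by
  have hy' : (y : ℚ_[p]) ≠ 0 := mod_cast hy
  have hx' : (x : ℚ_[p]) ≠ 0 := by rwa [← norm_ne_zero_iff, h, norm_ne_zero_iff]
  have hp1 : (1 : ℝ) < p := mod_cast (Fact.out : p.Prime).one_lt
  refine ⟨mod_cast hx', ?_⟩
  rwa [Padic.norm_eq_zpow_neg_valuation hx', Padic.norm_eq_zpow_neg_valuation hy',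
    zpow_right_inj₀ (by linarith) hp1.ne', neg_inj, Padic.valuation_ratCast,
    Padic.valuation_ratCast] at h

theorem zpow_neg_lt_norm_of_padicValRat_lt {x : ℚ} (hx : x ≠ 0) {t : ℤ}
    (h : padicValRat p x < t) : (p : ℝ) ^ (-t) < ‖(x : ℚ_[p])‖ := by
  rw [Padic.norm_eq_zpow_neg_valuation (mod_cast hx), Padic.valuation_ratCast]
  exact zpow_lt_zpow_right₀ (mod_cast (Fact.out : p.Prime).one_lt) (neg_lt_neg h)

end Padic

/-- let `p` be an odd prime, `n` a positive even integer with `B_n ≠ 0`,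
`t₀ := max(v_p(n), v_p(B_n/n))` and `t := t₀ + 1`.  If `m` is a positive integer with
`m ≡ n (mod (p−1)p^t)`, then `B_m ≠ 0` and `v_p(B_m) = v_p(B_n)`.  (Here `t₀ ≥ v_p(n) ≥ 0`,
so taking `Int.toNat` is harmless.) -/
theorem padicValRat_bernoulli_constant_on_congruence_class (p : ℕ) (hp : p.Prime)
    (hodd : Odd p) (n : ℕ) (hn : 0 < n) (hne : Even n) (hB : bernoulli n ≠ 0)
    (t : ℕ)
    (ht : t = (max ((padicValNat p n : ℤ)) (padicValRat p (bernoulli n / n))).toNat + 1)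
    (m : ℕ) (hm : 0 < m) (hmn : m ≡ n [MOD (p - 1) * p ^ t]) :
    bernoulli m ≠ 0 ∧ padicValRat p (bernoulli m) = padicValRat p (bernoulli n) := by
  have : Fact p.Prime := ⟨hp⟩
  have hp1 : Even (p - 1) := Nat.Odd.sub_odd hodd odd_one
  have hn0 : (n : ℚ) ≠ 0 := mod_cast hn.ne'
  have hmn1 : m ≡ n [MOD p - 1] := hmn.of_dvd (dvd_mul_right _ _)
  have hme : Even m := by
    rw [even_iff_two_dvd] at *
    exact ((hmn1.of_dvd hp1).dvd_iff dvd_rfl).2 hne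
  refine padicValRat_eq_of_norm_eq hB ?_
  by_cases hpn : p - 1 ∣ n
  · rw [norm_bernoulli_of_sub_one_dvd hm.ne' hme ((hmn1.dvd_iff dvd_rfl).2 hpn),
      norm_bernoulli_of_sub_one_dvd hn.ne' hne hpn]
  · have hm1 : 1 < m := by grind
    have hn1 : 1 < n := by grind
    have hdiv := norm_bernoulli_div_eq (p := p) (t := t) (by lia) hm1 hn1 hpn hmn (by
      have := zpow_neg_lt_norm_of_padicValRat_lt (p := p) (t := t) (div_ne_zero hB hn0) (by lia)
      push_cast at this
      exact this)
    have hmn_norm : ‖(m : ℚ_[p])‖ = ‖(n : ℚ_[p])‖ := by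
      refine Padic.norm_eq_of_norm_sub_lt_right (lt_of_le_of_lt (b := (p : ℝ) ^ (-t : ℤ)) ?_ ?_)
      · have h := (Padic.norm_int_le_pow_iff_dvd (p := p) ((m : ℤ) - n) t).2
          (by exact_mod_cast (hmn.of_dvd (dvd_mul_left _ _)).symm.dvd)
        push_cast at h
        exact h
      · have := zpow_neg_lt_norm_of_padicValRat_lt (p := p) (t := t) hn0
          (by rw [padicValRat.of_nat]; lia)
        rwa [Rat.cast_natCast] at this
    have hn0' : ‖(n : ℚ_[p])‖ ≠ 0 := norm_ne_zero_iff.2 (mod_cast hn.ne')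
    rwa [norm_div, norm_div, hmn_norm, div_left_inj' hn0'] at hdiv
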